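/- Let E be a finite collection of measurable sets and η ∈ (0,1), M ≥ 1 with μ({M_E(1_B) > η}) ≤ M μ(B) for all measurable B. Then for any γ with 0 < γ < 1−η, E can be partitioned into at most 1 + 2M(1−η)/(1−η−γ) · ‖E‖_{Carleson(μ)} subcollections E_i, each of which is γ-sparse with respect to μ (i.e., ‖E_i‖_{Sparse(μ)} ≥ γ). -/

import Mathlib

open MeasureTheory Set
open scoped ENNReal Classical

/-- If `l` bounds the overlap of the sets `E i` on `D`, then for any colouring of the sets, some
colour class covers at most an `l / N` fraction of `D`. -/
lemma exists_color_measure_inter_le {X ι : Type*} [MeasurableSpace X] (μ : Measure X)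
    (F : Finset ι) (E : ι → Set X) (hE : ∀ i ∈ F, MeasurableSet (E i)) {N : ℕ} (hN : 0 < N)
    (f : ι → Fin N) {D : Set X} (l : ℝ≥0∞)
    (hl : ∀ x ∈ D, ∑ i ∈ F, (E i).indicator (fun _ => (1 : ℝ≥0∞)) x ≤ l) :
    ∃ c : Fin N, N * μ (D ∩ ⋃ i ∈ F.filter (fun i => f i = c), E i) ≤ l * μ D := by
  have hsum : ∑ i ∈ F, μ (D ∩ E i) ≤ l * μ D := by
    calc ∑ i ∈ F, μ (D ∩ E i)
        = ∑ i ∈ F, ∫⁻ x in D, (E i).indicator (fun _ => (1 : ℝ≥0∞)) x ∂μ := by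
          refine Finset.sum_congr rfl fun i hi => ?_
          rw [lintegral_indicator (hE i hi), Measure.restrict_restrict (hE i hi),
            setLIntegral_const, one_mul, inter_comm]
      _ = ∫⁻ x in D, ∑ i ∈ F, (E i).indicator (fun _ => (1 : ℝ≥0∞)) x ∂μ :=
          (lintegral_finsetSum' _ fun i hi =>
            (measurable_const.indicator (hE i hi)).aemeasurable).symm
      _ ≤ ∫⁻ _ in D, l ∂μ := setLIntegral_mono measurable_const hl
      _ = l * μ D := setLIntegral_const _ _
  have hcolors : ∑ c : Fin N, μ (D ∩ ⋃ i ∈ F.filter (fun i => f i = c), E i) ≤ l * μ D := by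
    refine le_trans ?_ hsum
    rw [← Finset.sum_fiberwise F f]
    refine Finset.sum_le_sum fun c _ => ?_
    rw [inter_iUnion₂]
    exact measure_biUnion_finset_le _ _
  have : Nonempty (Fin N) := ⟨⟨0, hN⟩⟩
  by_contra! hlarge
  have hlt := ENNReal.sum_lt_sum_of_nonempty (s := (Finset.univ : Finset (Fin N)))
    Finset.univ_nonempty fun c _ => hlarge c
  rw [Finset.sum_const, Finset.card_univ, Fintype.card_fin, nsmul_eq_mul] at hlt
  refine absurd hlt (not_lt.2 ?_)
  rw [← Finset.mul_sum]
  exact mul_le_mul_right hcolors _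

/-- Under a restricted weak-type bound, a nonempty family with overlap constant `L` contains a set
that meets the region of overlap exceeding `2 * M * L` in at most an `η` fraction. -/
lemma exists_measure_highOverlap_inter_le {X ι : Type*} [MeasurableSpace X] (μ : Measure X)
    (s : Finset ι) (E : ι → Set X) (hmeas : ∀ i ∈ s, MeasurableSet (E i))
    (hpos : ∀ i ∈ s, 0 < μ (E i)) (hfin : ∀ i ∈ s, μ (E i) < ⊤) (η M L : ℝ≥0∞)
    (hMfin : M < ⊤) (hL : L < ⊤)
    (hmax : ∀ B : Set X, MeasurableSet B →
      μ {x | η < ⨆ i ∈ s, (E i).indicator (fun _ => μ (B ∩ E i) / μ (E i)) x} ≤ M * μ B)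
    (F : Finset ι) (hFs : F ⊆ s) (hF : F.Nonempty)
    (hcarleson : ∑ i ∈ F, μ (E i) ≤ L * μ (⋃ i ∈ F, E i)) :
    ∃ i ∈ F, μ ({x | 2 * M * L < ∑ j ∈ F, (E j).indicator (fun _ => (1 : ℝ≥0∞)) x} ∩ E i)
      ≤ η * μ (E i) := by
  set h : X → ℝ≥0∞ := fun x => ∑ j ∈ F, (E j).indicator (fun _ => (1 : ℝ≥0∞)) x with hh
  have hhm : Measurable h := Finset.measurable_fun_sum _ fun i hi =>
    measurable_const.indicator (hmeas i (hFs hi))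
  set B : Set X := {x | 2 * M * L < h x} with hB
  have hBm : MeasurableSet B := measurableSet_lt measurable_const hhm
  by_contra! hbad
  obtain ⟨k, hk⟩ := hF
  have hUpos : 0 < μ (⋃ i ∈ F, E i) :=
    (hpos k (hFs hk)).trans_le (measure_mono (subset_biUnion_of_mem (u := E) hk))
  have hU : μ (⋃ i ∈ F, E i) ≤ M * μ B := by
    refine le_trans (measure_mono fun x hx => ?_) (hmax B hBm)
    obtain ⟨i, hi, hxi⟩ := mem_iUnion₂.1 hx
    have h1 : η < μ (B ∩ E i) / μ (E i) :=
      (ENNReal.lt_div_iff_mul_lt (.inl (hpos i (hFs hi)).ne') (.inl (hfin i (hFs hi)).ne)).2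
        (hbad i hi)
    refine h1.trans_le ?_
    refine le_trans (by rw [indicator_of_mem hxi])
      (le_iSup₂ (f := fun i (_ : i ∈ s) => (E i).indicator (fun _ => μ (B ∩ E i) / μ (E i)) x)
        i (hFs hi))
  have hint : ∫⁻ x, h x ∂μ = ∑ i ∈ F, μ (E i) := by
    rw [hh, lintegral_finsetSum' _ fun i hi =>
      (measurable_const.indicator (hmeas i (hFs hi))).aemeasurable]
    exact Finset.sum_congr rfl fun i hi => by
      rw [lintegral_indicator (hmeas i (hFs hi)), setLIntegral_const, one_mul]
  have hmarkov : 2 * M * L * μ B ≤ ∑ i ∈ F, μ (E i) := by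
    rw [← hint]
    refine le_trans ?_ (mul_meas_ge_le_lintegral hhm (2 * M * L))
    gcongr
    exact fun x (hx : 2 * M * L < h x) => hx.le
  have hBfin : μ B ≠ ⊤ := by
    refine ne_top_of_le_ne_top (b := ∑ i ∈ F, μ (E i))
      (ENNReal.sum_lt_top.2 fun i hi => hfin i (hFs hi)).ne
      (le_trans (measure_mono fun x hx => ?_) (measure_biUnion_finset_le F E))
    obtain ⟨i, hi, hxi⟩ := Finset.exists_ne_zero_of_sum_ne_zero
      (ne_of_gt (lt_of_le_of_lt zero_le (show 2 * M * L < h x from hx)))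
    exact mem_iUnion₂.2 ⟨i, hi, mem_of_indicator_ne_zero hxi⟩
  have hLpos : L ≠ 0 := by
    rintro rfl
    rw [zero_mul] at hcarleson
    exact absurd ((Finset.single_le_sum (f := fun i => μ (E i)) (fun _ _ => zero_le) hk).trans
      hcarleson) (not_le.2 (hpos k (hFs hk)))
  have hpos' : L * (M * μ B) ≠ 0 := mul_ne_zero hLpos (hUpos.trans_le hU).ne'
  have hfin' : L * (M * μ B) ≠ ⊤ := ENNReal.mul_ne_top hL.ne (ENNReal.mul_ne_top hMfin.ne hBfin)
  have htwo : 2 * (L * (M * μ B)) ≤ L * (M * μ B) := by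
    calc 2 * (L * (M * μ B)) = 2 * M * L * μ B := by ring
      _ ≤ L * μ (⋃ i ∈ F, E i) := hmarkov.trans hcarleson
      _ ≤ L * (M * μ B) := by gcongr
  rw [two_mul] at htwo
  exact absurd htwo (not_le.2 (ENNReal.lt_add_right hfin' hpos'))

/-- If `D` fills a `1 - η` fraction of `R` and `U` a small fraction of `D`, then `D \ U` fills a
`γ` fraction of `R`. -/
lemma mul_le_measure_diff {X : Type*} [MeasurableSpace X] (μ : Measure X) {R B U : Set X}
    (hB : MeasurableSet B) (hU : MeasurableSet U) (hR : μ R < ⊤) {η γ l : ℝ≥0∞} (hη : η < 1)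
    (hγ : γ < 1 - η) {N : ℕ} (hN : 0 < N) (hl : l < ⊤)
    (hNl : l * (1 - η) / (1 - η - γ) ≤ N) (hBR : μ (B ∩ R) ≤ η * μ R)
    (hUR : N * μ ((R \ B) ∩ U) ≤ l * μ (R \ B)) :
    γ * μ R ≤ μ ((R \ B) \ U) := by
  have hsplit : μ (B ∩ R) + μ (R \ B) = μ R := by
    rw [inter_comm]; exact measure_inter_add_sdiff R hB
  have hsplit' : μ ((R \ B) ∩ U) + μ ((R \ B) \ U) = μ (R \ B) := measure_inter_add_sdiff _ hU
  have hm : μ (R \ B) ≠ ⊤ := ne_top_of_le_ne_top hR.ne (measure_mono sdiff_subset)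
  have ha : μ ((R \ B) ∩ U) ≠ ⊤ := ne_top_of_le_ne_top hm (measure_mono inter_subset_left)
  have hb : μ ((R \ B) \ U) ≠ ⊤ := ne_top_of_le_ne_top hm (measure_mono sdiff_subset)
  have hq : μ (B ∩ R) ≠ ⊤ := ne_top_of_le_ne_top hR.ne (measure_mono inter_subset_right)
  have hηt : η ≠ ⊤ := (hη.trans ENNReal.one_lt_top).ne
  have hγt : γ ≠ ⊤ := (hγ.trans_le (tsub_le_self.trans le_top)).ne
  have hδ : 1 - η - γ ≠ 0 := (tsub_pos_of_lt hγ).ne'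
  have hδt : 1 - η - γ ≠ ⊤ := by finiteness
  rw [ENNReal.div_le_iff hδ hδt] at hNl
  generalize μ (B ∩ R) = q at *
  generalize μ ((R \ B) ∩ U) = a at *
  generalize μ ((R \ B) \ U) = b at *
  generalize μ (R \ B) = m at *
  generalize μ R = r at *
  have hr := hR.ne
  have hl' := hl.ne
  have e1 : (1 - η - γ).toReal = 1 - η.toReal - γ.toReal := by
    rw [ENNReal.toReal_sub_of_le hγ.le (by finiteness),
      ENNReal.toReal_sub_of_le hη.le (by finiteness), ENNReal.toReal_one]
  have e2 : (1 - η).toReal = 1 - η.toReal := by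
    rw [ENNReal.toReal_sub_of_le hη.le (by finiteness), ENNReal.toReal_one]
  have k1 := ENNReal.toReal_mono (by finiteness) hNl
  have k2 := ENNReal.toReal_mono (by finiteness) hBR
  have k3 := ENNReal.toReal_mono (by finiteness) hUR
  have k4 := congrArg ENNReal.toReal hsplit
  have k5 := congrArg ENNReal.toReal hsplit'
  rw [ENNReal.toReal_add (by finiteness) (by finiteness)] at k4 k5
  simp only [ENNReal.toReal_mul, e1, e2, ENNReal.toReal_natCast] at k1 k2 k3
  have k6 : η.toReal < 1 := by
    simpa using (ENNReal.toReal_lt_toReal hηt ENNReal.one_ne_top).2 hη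
  rw [← ENNReal.toReal_le_toReal (by finiteness) hb, ENNReal.toReal_mul]
  have hN' : (0 : ℝ) < N := by exact_mod_cast hN
  have hγ0 : 0 ≤ γ.toReal := ENNReal.toReal_nonneg
  have hr0 : 0 ≤ r.toReal := ENNReal.toReal_nonneg
  generalize η.toReal = η' at *
  generalize γ.toReal = γ' at *
  generalize l.toReal = l' at *
  generalize (N : ℝ) = n at *
  have hnl : 0 ≤ n - l' := by
    have : 0 ≤ (n - l') * (1 - η') := by nlinarith [mul_nonneg hN'.le hγ0]
    exact nonneg_of_mul_nonneg_left this (by linarith)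
  refine le_of_mul_le_mul_left ?_ hN'
  calc n * (γ' * r.toReal) ≤ (n - l') * ((1 - η') * r.toReal) := by nlinarith
    _ ≤ (n - l') * m.toReal := mul_le_mul_of_nonneg_left (by linarith) hnl
    _ ≤ n * b.toReal := by rw [← k5] at k3 ⊢; linarith

theorem stmt18 {X : Type*} [MeasurableSpace X] (μ : Measure X)
    {ι : Type*} (s : Finset ι) (E : ι → Set X)
    (hmeas : ∀ i ∈ s, MeasurableSet (E i))
    (hpos : ∀ i ∈ s, 0 < μ (E i)) (hfin : ∀ i ∈ s, μ (E i) < ⊤)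
    (η M : ℝ≥0∞) (hη0 : 0 < η) (hη1 : η < 1) (hM1 : 1 ≤ M) (hMfin : M < ⊤)
    (hmax : ∀ B : Set X, MeasurableSet B →
      μ {x | η < ⨆ i ∈ s, (E i).indicator (fun _ => μ (B ∩ E i) / μ (E i)) x} ≤ M * μ B)
    (γ : ℝ≥0∞) (hγ0 : 0 < γ) (hγ : γ < 1 - η) :
    ∃ N : ℕ,
      (N : ℝ≥0∞) ≤ 1 + 2 * M * (1 - η) / (1 - η - γ) *
        (⨆ F ∈ s.powerset, (∑ i ∈ F, μ (E i)) / μ (⋃ i ∈ F, E i)) ∧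
      ∃ f : ι → Fin N, ∀ b : Fin N,
        ∃ φ : ι → X → ℝ≥0∞,
          (∀ i ∈ s.filter (fun i => f i = b), Measurable (φ i)) ∧
          (∀ i ∈ s.filter (fun i => f i = b), γ * μ (E i) ≤ ∫⁻ x in E i, φ i x ∂μ) ∧
          (∀ x, ∑ i ∈ s.filter (fun i => f i = b), φ i x ≤ 1) := by
  set L : ℝ≥0∞ := ⨆ F ∈ s.powerset, (∑ i ∈ F, μ (E i)) / μ (⋃ i ∈ F, E i) with hLdef
  have hL : L < ⊤ := by
    refine lt_of_le_of_lt (iSup₂_le fun F hF => ENNReal.div_le_of_le_mul ?_)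
      (ENNReal.natCast_lt_top s.card)
    calc ∑ i ∈ F, μ (E i) ≤ F.card • μ (⋃ i ∈ F, E i) :=
          Finset.sum_le_card_nsmul _ _ _ fun i hi =>
            measure_mono (subset_biUnion_of_mem (u := E) hi)
      _ ≤ s.card * μ (⋃ i ∈ F, E i) := by
          rw [nsmul_eq_mul]
          gcongr
          exact Finset.mem_powerset.1 hF
  have hcarleson : ∀ F ⊆ s, ∑ i ∈ F, μ (E i) ≤ L * μ (⋃ i ∈ F, E i) := by
    intro F hF
    rcases F.eq_empty_or_nonempty with rfl | ⟨k, hk⟩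
    · simp
    refine (ENNReal.div_le_iff ?_ ?_).1 (le_iSup₂ (f := fun (F : Finset ι) (_ : F ∈ s.powerset) =>
      (∑ i ∈ F, μ (E i)) / μ (⋃ i ∈ F, E i)) F (Finset.mem_powerset.2 hF))
    · exact ((hpos k (hF hk)).trans_le (measure_mono (subset_biUnion_of_mem (u := E) hk))).ne'
    · exact ne_top_of_le_ne_top (ENNReal.sum_lt_top.2 fun i hi => hfin i (hF hi)).ne
        (measure_biUnion_finset_le F E)
  have hδ : 1 - η - γ ≠ 0 := (tsub_pos_of_lt hγ).ne'
  have hl : 2 * M * L < ⊤ := by finiteness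
  set q : ℝ≥0∞ := 2 * M * (1 - η) / (1 - η - γ) * L with hq
  have hqt : q ≠ ⊤ := ENNReal.mul_ne_top (ENNReal.div_ne_top (by finiteness) hδ) hL.ne
  obtain ⟨N, hN0, hN1, hqN⟩ : ∃ N : ℕ, 0 < N ∧ (N : ℝ≥0∞) ≤ 1 + q ∧ q ≤ N := by
    clear_value q
    lift q to NNReal using hqt
    refine ⟨⌊q⌋₊ + 1, Nat.succ_pos _, ?_, ?_⟩
    · have := Nat.floor_le (zero_le : 0 ≤ q)
      rw [add_comm]
      push_cast
      gcongr
      exact_mod_cast this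
    · exact_mod_cast (Nat.lt_floor_add_one q).le
  refine ⟨N, hN1, ?_⟩
  have key : ∀ F : Finset ι, F ⊆ s → ∃ (f : ι → Fin N) (A : ι → Set X),
      (∀ i ∈ F, MeasurableSet (A i) ∧ A i ⊆ E i ∧ γ * μ (E i) ≤ μ (A i)) ∧
      ∀ i ∈ F, ∀ j ∈ F, i ≠ j → f i = f j → Disjoint (A i) (A j) := by
    intro F
    induction F using Finset.strongInduction with
    | H F ih =>
    intro hFs
    rcases F.eq_empty_or_nonempty with rfl | hF
    · exact ⟨fun _ => ⟨0, hN0⟩, fun _ => ∅, by simp, by simp⟩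
    obtain ⟨k, hk, hkB⟩ := exists_measure_highOverlap_inter_le μ s E hmeas hpos hfin η M L hMfin hL
      hmax F hFs hF (hcarleson F hFs)
    set B : Set X := {x | 2 * M * L < ∑ j ∈ F, (E j).indicator (fun _ => (1 : ℝ≥0∞)) x} with hB
    have hBm : MeasurableSet B := measurableSet_lt measurable_const
      (Finset.measurable_fun_sum _ fun i hi => measurable_const.indicator (hmeas i (hFs hi)))
    have hsub : F.erase k ⊆ s := (Finset.erase_subset _ _).trans hFs
    obtain ⟨f, A, hA, hdisj⟩ := ih (F.erase k) (Finset.erase_ssubset hk) hsub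
    obtain ⟨c, hc⟩ := exists_color_measure_inter_le μ (F.erase k) E
      (fun i hi => hmeas i (hsub hi)) hN0 f (D := E k \ B) (2 * M * L)
      (fun x hx => (Finset.sum_le_sum_of_subset (Finset.erase_subset k F)).trans
        (not_lt.1 hx.2))
    set U : Set X := ⋃ i ∈ (F.erase k).filter (fun i => f i = c), E i with hU
    have hUm : MeasurableSet U := Finset.measurableSet_biUnion _ fun i hi =>
      hmeas i (hsub (Finset.mem_filter.1 hi).1)
    have hbig : γ * μ (E k) ≤ μ ((E k \ B) \ U) := by
      refine mul_le_measure_diff μ hBm hUm (hfin k (hFs hk)) hη1 hγ hN0 hl ?_ hkB hc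
      refine le_trans (le_of_eq ?_) hqN
      rw [hq, div_eq_mul_inv, div_eq_mul_inv]
      ring
    have hnew : ∀ i ∈ F, i ≠ k → f i = c → Disjoint ((E k \ B) \ U) (A i) := by
      intro i hi hik hic
      have hi' := Finset.mem_erase.2 ⟨hik, hi⟩
      refine disjoint_sdiff_left.mono_right ((hA i hi').2.1.trans ?_)
      exact subset_biUnion_of_mem (u := E) (Finset.mem_filter.2 ⟨hi', hic⟩)
    refine ⟨Function.update f k c, Function.update A k ((E k \ B) \ U), ?_, ?_⟩
    · intro i hi
      by_cases hik : i = k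
      · subst hik
        rw [Function.update_self]
        exact ⟨((hmeas i (hFs hi)).diff hBm).diff hUm,
          sdiff_subset.trans sdiff_subset, hbig⟩
      · rw [Function.update_of_ne hik]
        exact hA i (Finset.mem_erase.2 ⟨hik, hi⟩)
    · intro i hi j hj hij hfij
      by_cases hik : i = k
      · subst hik
        rw [Function.update_self, Function.update_of_ne hij.symm] at hfij ⊢
        exact hnew j hj hij.symm hfij.symm
      · by_cases hjk : j = k
        · subst hjk
          rw [Function.update_self, Function.update_of_ne hij] at hfij ⊢
          exact (hnew i hi hij hfij).symm
        · rw [Function.update_of_ne hik, Function.update_of_ne hjk] at hfij ⊢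
          exact hdisj i (Finset.mem_erase.2 ⟨hik, hi⟩) j (Finset.mem_erase.2 ⟨hjk, hj⟩) hij hfij
  obtain ⟨f, A, hA, hdisj⟩ := key s subset_rfl
  refine ⟨f, fun b => ⟨fun i => (A i).indicator 1, fun i hi => ?_, fun i hi => ?_, fun x => ?_⟩⟩
  · exact measurable_one.indicator (hA i (Finset.mem_filter.1 hi).1).1
  · obtain ⟨hAm, hAE, hAγ⟩ := hA i (Finset.mem_filter.1 hi).1
    rwa [lintegral_indicator_one hAm, Measure.restrict_apply hAm, inter_eq_left.2 hAE]
  · by_cases hx : ∃ i ∈ s.filter (fun i => f i = b), x ∈ A i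
    · obtain ⟨i, hi, hxi⟩ := hx
      rw [Finset.sum_eq_single_of_mem i hi]
      · exact (indicator_of_mem hxi _).le
      intro j hj hji
      rw [Finset.mem_filter] at hi hj
      exact indicator_of_notMem (fun hxj => disjoint_left.1
        (hdisj j hj.1 i hi.1 hji (hj.2.trans hi.2.symm)) hxj hxi) _
    · push Not at hx
      rw [Finset.sum_eq_zero fun i hi => indicator_of_notMem (hx i hi) _]
      exact zero_le_one
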